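/- Suppose the Borel probability measure α on Ω is C*-Gibbs for a Hölder potential U. Let g : Ω → ℝ be continuous, λ ∈ ℝ, and suppose X = U + g − g ∘ τ + λ is Hölder continuous. Then α is quasi-C*-Gibbs for X. -/

import Mathlib

open MeasureTheory Filter
open scoped ENNReal

noncomputable section

/-- The two-sided full shift space `Ω = {1,…,d}^ℤ` (alphabet `Fin d`). -/
abbrev Omega (d : ℕ) : Type := ℤ → Fin d

/-- The shift map `τ`, `(τ x) j = x (j+1)`. -/
def tau (d : ℕ) (x : Omega d) : Omega d := fun j => x (j + 1)

/-- The `k`-th iterate of the shift (`k ∈ ℤ`): `(τ^k x) j = x (j + k)`. -/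
def tauZ (d : ℕ) (k : ℤ) (x : Omega d) : Omega d := fun j => x (j + k)

/-- `x` and `y` are homoclinic: they differ in only finitely many coordinates. -/
def Homoclinic (d : ℕ) (x y : Omega d) : Prop := Set.Finite {j : ℤ | x j ≠ y j}

/-- `U` is Hölder continuous for the standard metric `dist x y = 2^{-N}`:
there are `C > 0` and `0 < θ < 1` with `|U x - U y| ≤ C θ^N` whenever
`x` and `y` agree on all coordinates `|j| ≤ N`. -/
def HolderPotential (d : ℕ) (U : Omega d → ℝ) : Prop :=
  ∃ C θ : ℝ, 0 < C ∧ 0 < θ ∧ θ < 1 ∧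
    ∀ (x y : Omega d) (N : ℕ), (∀ j : ℤ, |j| ≤ (N : ℤ) → x j = y j) →
      |U x - U y| ≤ C * θ ^ N

/-- `U` depends on only finitely many coordinates. -/
def FiniteRange (d : ℕ) (U : Omega d → ℝ) : Prop :=
  ∃ s : Finset ℤ, ∀ x y : Omega d, (∀ j ∈ s, x j = y j) → U x = U y

/-- `V(x,y) = ∑_{k ∈ ℤ} (U(τ^k x) - U(τ^k y))`. -/
def Vfun (d : ℕ) (U : Omega d → ℝ) (x y : Omega d) : ℝ :=
  ∑' k : ℤ, (U (tauZ d k x) - U (tauZ d k y))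

/-- The cylinder `{z : z_j = a_j for -n ≤ j ≤ m}`. -/
def cyl (d : ℕ) (n m : ℕ) (a : ℤ → Fin d) : Set (Omega d) :=
  {z | ∀ j : ℤ, -(n : ℤ) ≤ j → j ≤ (m : ℤ) → z j = a j}

/-- The conjugating homeomorphism with window `-n ≤ j ≤ m` and target word `b`:
it replaces the coordinates in the window by those of `b` and keeps the rest. -/
def conjMap (d : ℕ) (n m : ℕ) (b : ℤ → Fin d) (z : Omega d) : Omega d :=
  fun j => if -(n : ℤ) ≤ j ∧ j ≤ (m : ℤ) then b j else z j

/-- `α` is a C*-Gibbs measure for `U` (at inverse temperature `β = 1`):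
for every symmetric conjugating homeomorphism `(O, φ)` and every continuous
`f : Ω → ℂ`, `∫_O e^{-V(z, φ z)} f(φ z) dα = ∫_{φ(O)} f dα`. -/
def CStarGibbs (d : ℕ) (U : Omega d → ℝ) (α : Measure (Omega d)) : Prop :=
  ∀ n : ℕ, 1 ≤ n → ∀ (a b : ℤ → Fin d) (f : Omega d → ℂ), Continuous f →
    ∫ z in cyl d n n a,
        (Real.exp (-(Vfun d U z (conjMap d n n b z))) : ℂ) * f (conjMap d n n b z) ∂α
      = ∫ z in cyl d n n b, f z ∂α

/-- `α` is a quasi-C*-Gibbs measure for `U`: there are constants `d₁, d₂ > 0`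
such that for every conjugating homeomorphism `(O, φ)` and every nonnegative
continuous `f : Ω → ℝ`,
`d₁ ∫_O e^{-V(z,φz)} f(φ z) dα ≤ ∫_{φ(O)} f dα ≤ d₂ ∫_O e^{-V(z,φz)} f(φ z) dα`. -/
def QuasiCStarGibbs (d : ℕ) (U : Omega d → ℝ) (α : Measure (Omega d)) : Prop :=
  ∃ d₁ d₂ : ℝ, 0 < d₁ ∧ 0 < d₂ ∧
    ∀ (n m : ℕ), 1 ≤ n → 1 ≤ m → ∀ (a b : ℤ → Fin d) (f : Omega d → ℝ),
      Continuous f → (∀ z, 0 ≤ f z) →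
      (d₁ * ∫ z in cyl d n m a,
          Real.exp (-(Vfun d U z (conjMap d n m b z))) * f (conjMap d n m b z) ∂α
        ≤ ∫ z in cyl d n m b, f z ∂α) ∧
      (∫ z in cyl d n m b, f z ∂α
        ≤ d₂ * ∫ z in cyl d n m a,
            Real.exp (-(Vfun d U z (conjMap d n m b z))) * f (conjMap d n m b z) ∂α)

/-- The future cylinder `{z : z_k = a_k for 1 ≤ k ≤ s}`. -/
def futureCyl (d : ℕ) (s : ℕ) (a : ℕ → Fin d) : Set (Omega d) :=
  {z | ∀ k : ℕ, 1 ≤ k → k ≤ s → z (k : ℤ) = a k}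

/-- The Birkhoff sum `∑_{k=0}^{s-1} U(τ^k x)`. -/
def birkhoff (d : ℕ) (U : Omega d → ℝ) (s : ℕ) (x : Omega d) : ℝ :=
  ∑ k ∈ Finset.range s, U (tauZ d (k : ℤ) x)

/-- `ρ` is the equilibrium (Gibbs) probability for `U`: it is `τ`-invariant and
satisfies Bowen's inequalities. -/
def IsEquilibrium (d : ℕ) (U : Omega d → ℝ) (ρ : Measure (Omega d)) : Prop :=
  Measure.map (tau d) ρ = ρ ∧
  ∃ C₁ C₂ P : ℝ, 0 < C₁ ∧ 0 < C₂ ∧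
    ∀ s : ℕ, 1 ≤ s → ∀ (a : ℕ → Fin d) (x : Omega d),
      (∀ k : ℕ, 1 ≤ k → k ≤ s → x (k : ℤ) = a k) →
      C₁ ≤ (ρ (futureCyl d s a)).toReal * Real.exp (P * s - birkhoff d U s x) ∧
      (ρ (futureCyl d s a)).toReal * Real.exp (P * s - birkhoff d U s x) ≤ C₂

/-- The point whose coordinates `1, 2, 3, …` are `j, x₁, x₂, …`. -/
def prepend (d : ℕ) (j : Fin d) (x : Omega d) : Omega d :=
  fun k => if k = 1 then j else x (k - 1)

/-- A potential depending on the coordinates `x₁, …, x_r` is normalized if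
`∑_{j=1}^d exp(f(j, x₁, …, x_{r-1})) = 1` for all choices of `x₁, …, x_{r-1}`. -/
def Normalized (d : ℕ) (U : Omega d → ℝ) : Prop :=
  ∀ x : Omega d, ∑ j : Fin d, Real.exp (U (prepend d j x)) = 1

section ShiftSpace

variable {d : ℕ}

lemma continuous_tauZ (k : ℤ) : Continuous (tauZ d k) :=
  continuous_pi fun j => continuous_apply (j + k)

lemma continuous_conjMap (n m : ℕ) (b : ℤ → Fin d) : Continuous (conjMap d n m b) := by
  refine continuous_pi fun j => ?_
  by_cases h : -(n : ℤ) ≤ j ∧ j ≤ (m : ℤ)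
  · simpa only [conjMap, if_pos h] using continuous_const
  · simpa only [conjMap, if_neg h] using continuous_apply j

lemma measurableSet_cyl (n m : ℕ) (a : ℤ → Fin d) : MeasurableSet (cyl d n m a) := by
  have : cyl d n m a = ⋂ j : ℤ, {z | -(n : ℤ) ≤ j → j ≤ (m : ℤ) → z j = a j} := by
    ext z
    simp [cyl]
  rw [this]
  refine MeasurableSet.iInter fun j => ?_
  by_cases h : -(n : ℤ) ≤ j ∧ j ≤ (m : ℤ)
  · simp only [h.1, h.2, true_imp_iff]
    exact measurableSet_eq_fun (measurable_pi_apply j) measurable_const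
  · have : {z : Omega d | -(n : ℤ) ≤ j → j ≤ (m : ℤ) → z j = a j} = Set.univ :=
      Set.eq_univ_of_forall fun z h₁ h₂ => absurd ⟨h₁, h₂⟩ h
    rw [this]
    exact MeasurableSet.univ

lemma HolderPotential.continuous {U : Omega d → ℝ} (hU : HolderPotential d U) :
    Continuous U := by
  obtain ⟨C, θ, hC, hθ, hθ1, h⟩ := hU
  refine continuous_iff_continuousAt.2 fun x => Metric.tendsto_nhds.2 fun ε hε => ?_
  have hlim : Tendsto (fun N : ℕ => C * θ ^ N) atTop (nhds 0) := by
    simpa using (tendsto_pow_atTop_nhds_zero_of_lt_one hθ.le hθ1).const_mul C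
  obtain ⟨N, hN⟩ := (hlim.eventually (gt_mem_nhds hε)).exists
  have hev : ∀ᶠ y : Omega d in nhds x, ∀ j ∈ Finset.Icc (-(N : ℤ)) N, y j = x j := by
    refine (Finset.eventually_all _).2 fun j _ => ?_
    exact (continuous_apply j).continuousAt.eventually
      ((isOpen_discrete {x j}).mem_nhds rfl)
  filter_upwards [hev] with y hy
  exact (h y x N fun j hj => hy j (Finset.mem_Icc.2 (abs_le.1 hj))).trans_lt hN

/-- The terms of `Vfun` decay geometrically, uniformly over all pairs of points that agree outside
a fixed window. -/
lemma HolderPotential.exists_summable_bound {U : Omega d → ℝ} (hU : HolderPotential d U)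
    (N : ℕ) : ∃ B : ℤ → ℝ, Summable B ∧ ∀ x y : Omega d,
      (∀ j : ℤ, (N : ℤ) < |j| → x j = y j) →
      ∀ k : ℤ, |U (tauZ d k x) - U (tauZ d k y)| ≤ B k := by
  have hcont := hU.continuous
  obtain ⟨C, θ, hC, hθ, hθ1, h⟩ := hU
  obtain ⟨M, hM⟩ := isCompact_univ.exists_bound_of_continuousOn hcont.continuousOn
  have hM (x : Omega d) : |U x| ≤ |M| := (hM x trivial).trans (le_abs_self M)
  have hsum : Summable fun k : ℤ => θ ^ k.natAbs := by
    have := summable_geometric_of_lt_one hθ.le hθ1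
    exact Summable.of_nat_of_neg (by simpa using this) (by simpa using this)
  refine ⟨fun k => (2 * |M| + C) * (θ ^ (N + 1))⁻¹ * θ ^ k.natAbs, hsum.mul_left _,
    fun x y hxy k => ?_⟩
  have hp : 0 < θ ^ (N + 1) := pow_pos hθ _
  rcases le_or_gt k.natAbs N with hk | hk
  · have h1 : |U (tauZ d k x) - U (tauZ d k y)| ≤ 2 * |M| := by
      have := abs_sub (U (tauZ d k x)) (U (tauZ d k y))
      linarith [hM (tauZ d k x), hM (tauZ d k y)]
    have h2 : 1 ≤ (θ ^ (N + 1))⁻¹ * θ ^ k.natAbs := by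
      rw [inv_mul_eq_div, one_le_div hp]
      exact pow_le_pow_of_le_one hθ.le hθ1.le (by omega)
    simp only [mul_assoc]
    nlinarith [abs_nonneg M]
  · have h1 := h (tauZ d k x) (tauZ d k y) (k.natAbs - (N + 1)) fun j hj => hxy _ (by
      rw [lt_abs]
      rw [abs_le] at hj
      omega)
    have h2 : θ ^ (k.natAbs - (N + 1)) = (θ ^ (N + 1))⁻¹ * θ ^ k.natAbs := by
      rw [inv_mul_eq_div, eq_div_iff hp.ne', ← pow_add]
      congr 1
      omega
    rw [h2] at h1
    simp only [mul_assoc]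
    have h3 : 0 < (θ ^ (N + 1))⁻¹ * θ ^ k.natAbs := by positivity
    nlinarith [abs_nonneg M]

lemma HolderPotential.summable {U : Omega d → ℝ} (hU : HolderPotential d U) {N : ℕ}
    {x y : Omega d} (hxy : ∀ j : ℤ, (N : ℤ) < |j| → x j = y j) :
    Summable fun k : ℤ => U (tauZ d k x) - U (tauZ d k y) := by
  obtain ⟨B, hB, hle⟩ := hU.exists_summable_bound N
  exact hB.of_norm_bounded (hle x y hxy)

lemma eq_conjMap_of_max_lt {n m : ℕ} (b : ℤ → Fin d) (z : Omega d) (j : ℤ)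
    (hj : ((max n m : ℕ) : ℤ) < |j|) : z j = conjMap d n m b z j := by
  have : ¬(-(n : ℤ) ≤ j ∧ j ≤ (m : ℤ)) := by
    rintro ⟨h₁, h₂⟩
    rw [lt_abs] at hj
    omega
  simp [conjMap, this]

lemma HolderPotential.continuous_Vfun_conjMap {U : Omega d → ℝ} (hU : HolderPotential d U)
    (n m : ℕ) (b : ℤ → Fin d) :
    Continuous fun z => Vfun d U z (conjMap d n m b z) := by
  obtain ⟨B, hB, hle⟩ := hU.exists_summable_bound (max n m)
  refine continuous_tsum (fun k => ?_) hB fun k z =>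
    hle z (conjMap d n m b z) (eq_conjMap_of_max_lt b z) k
  exact (hU.continuous.comp (continuous_tauZ k)).sub
    (hU.continuous.comp ((continuous_tauZ k).comp (continuous_conjMap n m b)))

/-- A continuous observable becomes asymptotically equal along the orbits of two homoclinic
points. -/
lemma tendsto_sub_tauZ_cofinite {g : Omega d → ℝ} (hg : Continuous g) {x y : Omega d}
    (hxy : Homoclinic d x y) :
    Tendsto (fun k : ℤ => g (tauZ d k x) - g (tauZ d k y)) cofinite (nhds 0) := by
  refine tendsto_iff_ultrafilter _ _ _ |>.2 fun F hF => ?_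
  obtain ⟨p, -, hp⟩ := isCompact_univ.ultrafilter_le_nhds (F.map fun k => tauZ d k x) (by simp)
  have hp : Tendsto (fun k => tauZ d k x) F (nhds p) := hp
  have hq : Tendsto (fun k => tauZ d k y) F (nhds p) := by
    refine tendsto_pi_nhds.2 fun j => (tendsto_pi_nhds.1 hp j).congr' (hF ?_)
    refine (hxy.preimage (f := fun k : ℤ => j + k) fun _ _ _ _ h => ?_).subset ?_
    · simpa using h
    · intro k hk
      simpa [tauZ] using hk
  simpa using ((hg.tendsto p).comp hp).sub ((hg.tendsto p).comp hq)

lemma tsum_int_sub_succ_eq_zero {h : ℤ → ℝ} (hlim : Tendsto h cofinite (nhds 0))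
    (hsum : Summable fun k : ℤ => h k - h (k + 1)) : ∑' k : ℤ, (h k - h (k + 1)) = 0 := by
  have h1 := hsum.hasSum.nat_add_neg_add_one.tendsto_sum_nat
  have h2 (n : ℕ) : ∑ k ∈ Finset.range n,
      ((h (k : ℤ) - h ((k : ℤ) + 1)) + (h (-((k : ℤ) + 1)) - h (-((k : ℤ) + 1) + 1)))
      = h (-(n : ℤ)) - h n := by
    induction n with
    | zero => simp
    | succ n ih =>
      rw [Finset.sum_range_succ, ih, show -((n : ℤ) + 1) + 1 = -n by ring]
      push_cast
      ring
  have hpos : Tendsto (fun n : ℕ => h n) atTop (nhds 0) := by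
    rw [← Nat.cofinite_eq_atTop]
    exact hlim.comp Nat.cast_injective.tendsto_cofinite
  have hneg : Tendsto (fun n : ℕ => h (-(n : ℤ))) atTop (nhds 0) := by
    rw [← Nat.cofinite_eq_atTop]
    exact hlim.comp (neg_injective.comp Nat.cast_injective).tendsto_cofinite
  refine tendsto_nhds_unique (h1.congr h2) ?_
  simpa using hneg.sub hpos

lemma Vfun_add_coboundary {U g : Omega d → ℝ} {lam : ℝ} (hU : HolderPotential d U)
    (hg : Continuous g) (hX : HolderPotential d (fun x => U x + g x - g (tau d x) + lam))
    {N : ℕ} {x y : Omega d} (hxy : ∀ j : ℤ, (N : ℤ) < |j| → x j = y j) :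
    Vfun d (fun x => U x + g x - g (tau d x) + lam) x y = Vfun d U x y := by
  have htau (k : ℤ) (z : Omega d) : tau d (tauZ d k z) = tauZ d (k + 1) z := by
    ext j
    simp only [tau, tauZ]
    rw [show j + 1 + k = j + (k + 1) by ring]
  have hhom : Homoclinic d x y := by
    refine (Set.finite_Icc (-(N : ℤ)) N).subset fun j hj => ?_
    by_contra hcon
    exact hj (hxy j (not_le.1 fun hle => hcon (abs_le.1 hle)))
  have hterm (k : ℤ) : (U (tauZ d k x) + g (tauZ d k x) - g (tau d (tauZ d k x)) + lam)
      - (U (tauZ d k y) + g (tauZ d k y) - g (tau d (tauZ d k y)) + lam)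
      - (U (tauZ d k x) - U (tauZ d k y))
      = (g (tauZ d k x) - g (tauZ d k y)) - (g (tauZ d (k + 1) x) - g (tauZ d (k + 1) y)) := by
    rw [htau, htau]
    ring
  have hsX := hX.summable hxy
  have hsU := hU.summable hxy
  have hzero := tsum_int_sub_succ_eq_zero (tendsto_sub_tauZ_cofinite hg hhom)
    ((hsX.sub hsU).congr hterm)
  rw [← tsum_congr hterm, hsX.tsum_sub hsU] at hzero
  exact sub_eq_zero.1 hzero

/-- The word `a` with the letters at the positions in `I` replaced by those of `c`. -/
def overwrite (I : Finset ℤ) (a : ℤ → Fin d) (c : I → Fin d) (j : ℤ) : Fin d :=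
  if h : j ∈ I then c ⟨j, h⟩ else a j

/-- The positions of the symmetric window of radius `max n m` outside `[-n, m]`. -/
def windowGap (n m : ℕ) : Finset ℤ :=
  Finset.Icc (-((max n m : ℕ) : ℤ)) ((max n m : ℕ) : ℤ) \ Finset.Icc (-(n : ℤ)) m

lemma mem_windowGap {n m : ℕ} {j : ℤ} : j ∈ windowGap n m ↔
    (-((max n m : ℕ) : ℤ) ≤ j ∧ j ≤ ((max n m : ℕ) : ℤ)) ∧ ¬(-(n : ℤ) ≤ j ∧ j ≤ (m : ℤ)) := by
  simp only [windowGap, Finset.mem_sdiff, Finset.mem_Icc]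

lemma mem_cyl_overwrite {n m : ℕ} {a : ℤ → Fin d} {c : windowGap n m → Fin d} {z : Omega d} :
    z ∈ cyl d (max n m) (max n m) (overwrite _ a c) ↔
      z ∈ cyl d n m a ∧ ∀ i : windowGap n m, z i = c i := by
  constructor
  · intro h
    refine ⟨fun j h₁ h₂ => ?_, fun i => ?_⟩
    · have hj : j ∉ windowGap n m := fun hj => (mem_windowGap.1 hj).2 ⟨h₁, h₂⟩
      simpa [overwrite, hj] using h j (by omega) (by omega)
    · have hi := (mem_windowGap.1 i.2).1
      simpa [overwrite] using h i hi.1 hi.2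
  · rintro ⟨h, hc⟩ j h₁ h₂
    by_cases hj : j ∈ windowGap n m
    · simpa [overwrite, hj] using hc ⟨j, hj⟩
    · have hj' : -(n : ℤ) ≤ j ∧ j ≤ (m : ℤ) := by
        by_contra hcon
        exact hj (mem_windowGap.2 ⟨⟨h₁, h₂⟩, hcon⟩)
      simpa [overwrite, hj] using h j hj'.1 hj'.2

lemma conjMap_overwrite {n m : ℕ} {a b : ℤ → Fin d} {c : windowGap n m → Fin d} {z : Omega d}
    (hz : z ∈ cyl d (max n m) (max n m) (overwrite _ a c)) :
    conjMap d (max n m) (max n m) (overwrite _ b c) z = conjMap d n m b z := by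
  have hc := (mem_cyl_overwrite.1 hz).2
  funext j
  by_cases hj : j ∈ windowGap n m
  · obtain ⟨h₁, h₂⟩ := mem_windowGap.1 hj
    simp only [conjMap, if_pos h₁, if_neg h₂, overwrite, dif_pos hj]
    exact (hc ⟨j, hj⟩).symm
  · by_cases h₂ : -(n : ℤ) ≤ j ∧ j ≤ (m : ℤ)
    · have h₁ : -((max n m : ℕ) : ℤ) ≤ j ∧ j ≤ ((max n m : ℕ) : ℤ) := by omega
      simp only [conjMap, if_pos h₁, if_pos h₂, overwrite, dif_neg hj]
    · have h₁ : ¬(-((max n m : ℕ) : ℤ) ≤ j ∧ j ≤ ((max n m : ℕ) : ℤ)) :=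
        fun h₁ => hj (mem_windowGap.2 ⟨h₁, h₂⟩)
      simp only [conjMap, if_neg h₁, if_neg h₂]

lemma setIntegral_cyl_eq_sum {α : Measure (Omega d)} [IsFiniteMeasure α] {F : Omega d → ℝ}
    (hF : Continuous F) (n m : ℕ) (a : ℤ → Fin d) :
    ∫ z in cyl d n m a, F z ∂α = ∑ c : windowGap n m → Fin d,
      ∫ z in cyl d (max n m) (max n m) (overwrite _ a c), F z ∂α := by
  have hint : Integrable F α :=
    hF.integrable_of_hasCompactSupport (HasCompactSupport.of_compactSpace F)
  have hunion : cyl d n m a =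
      ⋃ c : windowGap n m → Fin d, cyl d (max n m) (max n m) (overwrite _ a c) := by
    ext z
    simp only [Set.mem_iUnion, mem_cyl_overwrite]
    exact ⟨fun hz => ⟨fun i => z i, hz, fun _ => rfl⟩, fun ⟨_, hz, _⟩ => hz⟩
  rw [hunion, integral_iUnion_fintype (fun _ => measurableSet_cyl _ _ _) _
    fun _ => hint.integrableOn]
  intro c c' hcc
  refine Set.disjoint_left.2 fun z hz hz' => hcc (funext fun i => ?_)
  rw [← (mem_cyl_overwrite.1 hz).2 i, ← (mem_cyl_overwrite.1 hz').2 i]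

/-- The C*-Gibbs identity extends from symmetric to arbitrary windows. -/
lemma CStarGibbs.setIntegral_eq {U : Omega d → ℝ} {α : Measure (Omega d)} [IsFiniteMeasure α]
    (hα : CStarGibbs d U α) (hU : HolderPotential d U) {n m : ℕ} (hn : 1 ≤ n)
    (a b : ℤ → Fin d) {f : Omega d → ℝ} (hf : Continuous f) :
    ∫ z in cyl d n m a,
        Real.exp (-(Vfun d U z (conjMap d n m b z))) * f (conjMap d n m b z) ∂α
      = ∫ z in cyl d n m b, f z ∂α := by
  have hF : Continuous fun z =>
      Real.exp (-(Vfun d U z (conjMap d n m b z))) * f (conjMap d n m b z) :=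
    (Real.continuous_exp.comp (hU.continuous_Vfun_conjMap n m b).neg).mul
      (hf.comp (continuous_conjMap n m b))
  rw [setIntegral_cyl_eq_sum hF, setIntegral_cyl_eq_sum hf]
  refine Finset.sum_congr rfl fun c _ => ?_
  have hsymm := hα (max n m) (le_max_of_le_left hn) (overwrite _ a c) (overwrite _ b c)
    (fun z => (f z : ℂ)) (Complex.continuous_ofReal.comp hf)
  simp only [← Complex.ofReal_mul, integral_complex_ofReal] at hsymm
  rw [← Complex.ofReal_injective hsymm]
  refine setIntegral_congr_fun (measurableSet_cyl _ _ _) fun z hz => ?_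
  simp only [conjMap_overwrite hz]

end ShiftSpace

/-- if `α` is C*-Gibbs for `U` and `X = U + g - g ∘ τ + λ` is
Hölder, with `g` continuous, then `α` is quasi-C*-Gibbs for `X`. -/
theorem coboundary_quasiGibbs (d : ℕ) (hd : 2 ≤ d) (U : Omega d → ℝ)
    (hU : HolderPotential d U) (α : Measure (Omega d)) (hα : IsProbabilityMeasure α)
    (hGibbs : CStarGibbs d U α) (g : Omega d → ℝ) (hg : Continuous g) (lam : ℝ)
    (hX : HolderPotential d (fun x => U x + g x - g (tau d x) + lam)) :
    QuasiCStarGibbs d (fun x => U x + g x - g (tau d x) + lam) α := by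
  refine ⟨1, 1, one_pos, one_pos, fun n m hn _ a b f hf _ => ?_⟩
  have hV (z : Omega d) := Vfun_add_coboundary hU hg hX (eq_conjMap_of_max_lt (n := n) (m := m) b z)
  simp only [hV, one_mul, hGibbs.setIntegral_eq hU hn a b hf, le_refl, and_self]
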